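/- Let 𝔉 = 𝔞 ⊕ F(𝔞) with bracket defined by [x,y]_𝔉 = [x,y]_𝔞, [x,𝐲]_𝔉 = ad_T(x)(𝐲) = −[𝐲,x]_𝔉, and [𝐲,𝐳]_𝔉 = [𝐲,𝐳]_T for x, y ∈ 𝔞 and 𝐲, 𝐳 ∈ F(𝔞). Then 𝔉 is a Lie algebra, and if 𝔞 = [𝔞,𝔞], then extending τ[t] to 𝔉 by τ[t](x) = x⊗1 for x ∈ 𝔞 gives a surjective Lie algebra homomorphism 𝔉 → 𝔞[t] with kernel ker τ[t], so that 𝔞[t] ≅ 𝔉 / ker τ[t]. -/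

import Mathlib

open TensorAlgebra TensorProduct Polynomial

noncomputable section

/-- The graded pieces `F^r(a)` of the free Lie algebra on the vector space `a`,
realized inside the tensor algebra `T(a)`:  `F¹(a) = ι(a)` and `F^{r+1}(a)` is spanned by
the commutators `ι(x) * y - y * ι(x)` with `x ∈ a`, `y ∈ F^r(a)`. -/
def Fr (a : Type*) [LieRing a] [LieAlgebra ℂ a] : ℕ → Submodule ℂ (TensorAlgebra ℂ a)
  | 0 => ⊥
  | 1 => LinearMap.range (TensorAlgebra.ι ℂ (M := a))
  | (r + 2) => Submodule.span ℂ
      {u | ∃ (x : a) (y : TensorAlgebra ℂ a), y ∈ Fr a (r + 1) ∧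
        u = TensorAlgebra.ι ℂ x * y - y * TensorAlgebra.ι ℂ x}

/-- The free Lie algebra `F(a) = ⊕_{r>0} F^r(a)` on the vector space `a`,
as a subspace of the tensor algebra. -/
def FLie (a : Type*) [LieRing a] [LieAlgebra ℂ a] : Submodule ℂ (TensorAlgebra ℂ a) :=
  ⨆ r, Fr a r

/-- `IsTau a τ` says that the linear map `τ` is (a linear extension to `T(a)` of) the canonical
Lie algebra homomorphism `τ : F(a) → a`: it is the identity on `F¹(a) = a` and takes the
commutator bracket of `T(a)` (restricted to `F(a)`) to the bracket of `a`. -/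
def IsTau (a : Type*) [LieRing a] [LieAlgebra ℂ a] (τ : TensorAlgebra ℂ a →ₗ[ℂ] a) : Prop :=
  (∀ x : a, τ (TensorAlgebra.ι ℂ x) = x) ∧
  ∀ r s : ℕ, ∀ u ∈ Fr a r, ∀ v ∈ Fr a s, τ (u * v - v * u) = ⁅τ u, τ v⁆

/-- The current algebra `a[t] = a ⊗ ℂ[t]`, with bracket `⁅x ⊗ f, y ⊗ g⁆ = ⁅x, y⁆ ⊗ fg`. -/
abbrev Cur (a : Type*) [LieRing a] [LieAlgebra ℂ a] : Type _ := Polynomial ℂ ⊗[ℂ] a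

/-- `IsTauT a τ τt` says that the linear map `τt` is (a linear extension to `T(a)` of) the map
`τ[t] : F(a) → a[t]` given by `τ[t](𝐱) = τ(𝐱) ⊗ t^r` for `𝐱 ∈ F^r(a)`. -/
def IsTauT (a : Type*) [LieRing a] [LieAlgebra ℂ a] (τ : TensorAlgebra ℂ a →ₗ[ℂ] a)
    (τt : TensorAlgebra ℂ a →ₗ[ℂ] Cur a) : Prop :=
  ∀ r : ℕ, ∀ u ∈ Fr a r, τt u = ((X : ℂ[X]) ^ r) ⊗ₜ[ℂ] (τ u)

end

noncomputable section

/-- `IsAdT a adT` says that `adT` is the diagonal adjoint action of `a` on its tensor algebra,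
i.e. `adT x` is the derivation of `T(a)` with `adT x (ι y) = ι ⁅x, y⁆`. -/
def IsAdT (a : Type*) [LieRing a] [LieAlgebra ℂ a]
    (adT : a →ₗ[ℂ] Module.End ℂ (TensorAlgebra ℂ a)) : Prop :=
  (∀ x : a, adT x 1 = 0) ∧
  (∀ x y : a, adT x (TensorAlgebra.ι ℂ y) = TensorAlgebra.ι ℂ ⁅x, y⁆) ∧
  (∀ (x : a) (u v : TensorAlgebra ℂ a), adT x (u * v) = adT x u * v + u * adT x v)

/-- The bracket of the semidirect product `𝔉 = a ⊕ F(a)`, written on the ambient space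
`a × T(a)`:  `⁅(x, 𝐲), (x', 𝐲')⁆ = (⁅x,x'⁆, adT x 𝐲' - adT x' 𝐲 + (𝐲𝐲' - 𝐲'𝐲))`. -/
def Fbr (a : Type*) [LieRing a] [LieAlgebra ℂ a]
    (adT : a →ₗ[ℂ] Module.End ℂ (TensorAlgebra ℂ a))
    (p q : a × TensorAlgebra ℂ a) : a × TensorAlgebra ℂ a :=
  (⁅p.1, q.1⁆, adT p.1 q.2 - adT q.1 p.2 + (p.2 * q.2 - q.2 * p.2))

/-- The extension of `τ[t]` to `𝔉 = a ⊕ F(a)`, sending `(x, 𝐲)` to `x ⊗ 1 + τ[t](𝐲)`. -/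
def PhiF (a : Type*) [LieRing a] [LieAlgebra ℂ a]
    (τt : TensorAlgebra ℂ a →ₗ[ℂ] Cur a) (p : a × TensorAlgebra ℂ a) : Cur a :=
  (1 : ℂ[X]) ⊗ₜ[ℂ] p.1 + τt p.2

end

theorem Fr_le_FLie (a : Type*) [LieRing a] [LieAlgebra ℂ a] (r : ℕ) : Fr a r ≤ FLie a :=
  le_iSup (Fr a) r

@[elab_as_elim]
theorem FLie_induction {a : Type*} [LieRing a] [LieAlgebra ℂ a]
    {P : ∀ u : TensorAlgebra ℂ a, u ∈ FLie a → Prop}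
    (mem : ∀ r, ∀ u, ∀ hu : u ∈ Fr a r, P u (Fr_le_FLie a r hu))
    (add : ∀ u v hu hv, P u hu → P v hv → P (u + v) (add_mem hu hv))
    {u : TensorAlgebra ℂ a} (hu : u ∈ FLie a) : P u hu :=
  Submodule.iSup_induction' (Fr a) (motive := P) mem (mem 0 0 (zero_mem _)) add hu

theorem Cur.add_lie {a : Type*} [LieRing a] [LieAlgebra ℂ a] (x y z : Cur a) :
    ⁅x + y, z⁆ = ⁅x, z⁆ + ⁅y, z⁆ :=
  LieRing.add_lie x y z

theorem Cur.lie_add {a : Type*} [LieRing a] [LieAlgebra ℂ a] (x y z : Cur a) :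
    ⁅x, y + z⁆ = ⁅x, y⁆ + ⁅x, z⁆ :=
  LieRing.lie_add x y z

theorem Cur.lie_skew {a : Type*} [LieRing a] [LieAlgebra ℂ a] (x y : Cur a) :
    -⁅y, x⁆ = ⁅x, y⁆ :=
  _root_.lie_skew x y

theorem Fr_succ_induction {a : Type*} [LieRing a] [LieAlgebra ℂ a]
    {P : ℕ → TensorAlgebra ℂ a → Prop}
    (gen : ∀ x : a, P 1 (ι ℂ x))
    (comm : ∀ (r : ℕ) (x : a), ∀ v ∈ Fr a (r + 1), P (r + 1) v →
      P (r + 2) (ι ℂ x * v - v * ι ℂ x))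
    (zero : ∀ r, P r 0)
    (add : ∀ r u v, P r u → P r v → P r (u + v))
    (smul : ∀ r (c : ℂ) u, P r u → P r (c • u))
    (r : ℕ) : ∀ u ∈ Fr a r, P r u := by
  induction r with
  | zero =>
    intro u hu
    rw [(Submodule.mem_bot ℂ).1 hu]
    exact zero 0
  | succ r ih =>
    cases r with
    | zero =>
      rintro u ⟨x, rfl⟩
      exact gen x
    | succ r =>
      intro u hu
      refine Submodule.span_induction ?_ (zero _) (fun u v _ _ => add _ u v)
        (fun c u _ => smul _ c u) hu
      rintro _ ⟨x, v, hv, rfl⟩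
      exact comm r x v hv (ih v hv)

theorem ι_mem_Fr_one {a : Type*} [LieRing a] [LieAlgebra ℂ a] (x : a) : ι ℂ x ∈ Fr a 1 :=
  ⟨x, rfl⟩

theorem ι_commutator_mem_Fr {a : Type*} [LieRing a] [LieAlgebra ℂ a] (x : a) {s : ℕ}
    {v : TensorAlgebra ℂ a} (hv : v ∈ Fr a s) : ι ℂ x * v - v * ι ℂ x ∈ Fr a (s + 1) := by
  cases s with
  | zero =>
    rw [(Submodule.mem_bot ℂ).1 hv]
    simp
  | succ s => exact Submodule.subset_span ⟨x, v, hv, rfl⟩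

theorem commutator_mem_Fr {a : Type*} [LieRing a] [LieAlgebra ℂ a] (r : ℕ) :
    ∀ u ∈ Fr a r, ∀ s, ∀ v ∈ Fr a s, u * v - v * u ∈ Fr a (r + s) := by
  refine Fr_succ_induction
    (P := fun r u => ∀ s, ∀ v ∈ Fr a s, u * v - v * u ∈ Fr a (r + s)) ?_ ?_ ?_ ?_ ?_ r
  · intro x s v hv
    rw [add_comm]
    exact ι_commutator_mem_Fr x hv
  · intro r x w _ ih s v hv
    have h₁ := ι_commutator_mem_Fr x (ih s v hv)
    have h₂ := ih (s + 1) _ (ι_commutator_mem_Fr x hv)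
    rw [show r + 2 + s = r + 1 + s + 1 by omega]
    rw [show r + 1 + (s + 1) = r + 1 + s + 1 by omega] at h₂
    convert sub_mem h₁ h₂ using 1
    noncomm_ring
  · intro r s v _
    simp
  · intro r u u' hu hu' s v hv
    convert add_mem (hu s v hv) (hu' s v hv) using 1
    noncomm_ring
  · intro r c u hu s v hv
    convert Submodule.smul_mem _ c (hu s v hv) using 1
    simp [smul_sub]

theorem commutator_mem_FLie {a : Type*} [LieRing a] [LieAlgebra ℂ a]
    {u v : TensorAlgebra ℂ a} (hu : u ∈ FLie a) (hv : v ∈ FLie a) :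
    u * v - v * u ∈ FLie a := by
  induction hu using FLie_induction with
  | mem r u hu =>
    induction hv using FLie_induction with
    | mem s v hv => exact Fr_le_FLie a _ (commutator_mem_Fr r u hu s v hv)
    | add v v' _ _ hv hv' =>
      convert add_mem hv hv' using 1
      noncomm_ring
  | add u u' _ _ hu hu' =>
    convert add_mem hu hu' using 1
    noncomm_ring

namespace IsAdT

variable {a : Type*} [LieRing a] [LieAlgebra ℂ a]
  {adT : a →ₗ[ℂ] Module.End ℂ (TensorAlgebra ℂ a)}

theorem commutator (h : IsAdT a adT) (x : a) (u v : TensorAlgebra ℂ a) :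
    adT x (u * v - v * u) =
      (adT x u * v - v * adT x u) + (u * adT x v - adT x v * u) := by
  rw [map_sub, h.2.2, h.2.2]
  abel

theorem mem_Fr (h : IsAdT a adT) (x : a) (r : ℕ) : ∀ u ∈ Fr a r, adT x u ∈ Fr a r := by
  refine Fr_succ_induction (P := fun r u => adT x u ∈ Fr a r) ?_ ?_ ?_ ?_ ?_ r
  · intro y
    rw [h.2.1]
    exact ι_mem_Fr_one _
  · intro r y v hv ih
    rw [h.commutator, h.2.1]
    exact add_mem (ι_commutator_mem_Fr _ hv) (ι_commutator_mem_Fr _ ih)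
  · intro r
    simp
  · intro r u v hu hv
    rw [map_add]
    exact add_mem hu hv
  · intro r c u hu
    rw [map_smul]
    exact Submodule.smul_mem _ _ hu

theorem mem_FLie (h : IsAdT a adT) (x : a) {u : TensorAlgebra ℂ a} (hu : u ∈ FLie a) :
    adT x u ∈ FLie a := by
  induction hu using FLie_induction with
  | mem r u hu => exact Fr_le_FLie a r (h.mem_Fr x r u hu)
  | add u v _ _ hu hv =>
    rw [map_add]
    exact add_mem hu hv

theorem apply_lie (h : IsAdT a adT) (x y : a) (u : TensorAlgebra ℂ a) :
    adT ⁅x, y⁆ u = adT x (adT y u) - adT y (adT x u) := by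
  induction u using TensorAlgebra.induction with
  | algebraMap c => simp [Algebra.algebraMap_eq_smul_one, h.1]
  | ι z => rw [h.2.1, h.2.1, h.2.1, h.2.1, h.2.1, lie_lie, map_sub]
  | mul u v hu hv =>
    simp only [h.2.2, map_add, hu, hv]
    noncomm_ring
  | add u v hu hv =>
    simp only [map_add, hu, hv]
    abel

theorem Fbr_jacobi (h : IsAdT a adT) (p q r : a × TensorAlgebra ℂ a) :
    Fbr a adT p (Fbr a adT q r) =
      Fbr a adT (Fbr a adT p q) r + Fbr a adT q (Fbr a adT p r) := by
  refine Prod.ext (leibniz_lie p.1 q.1 r.1) ?_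
  simp only [Fbr, Prod.snd_add, h.apply_lie, map_add, map_sub, h.2.2]
  noncomm_ring

theorem tau_apply (h : IsAdT a adT) {τ : TensorAlgebra ℂ a →ₗ[ℂ] a} (hτ : IsTau a τ) (x : a)
    (r : ℕ) : ∀ u ∈ Fr a r, τ (adT x u) = ⁅x, τ u⁆ := by
  refine Fr_succ_induction (P := fun _ u => τ (adT x u) = ⁅x, τ u⁆) ?_ ?_ ?_ ?_ ?_ r
  · intro y
    rw [h.2.1, hτ.1, hτ.1]
  · intro r y v hv ih
    rw [h.commutator, h.2.1, map_add, hτ.2 1 _ _ (ι_mem_Fr_one _) _ hv,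
      hτ.2 1 _ _ (ι_mem_Fr_one _) _ (h.mem_Fr x _ v hv), hτ.2 1 _ _ (ι_mem_Fr_one _) _ hv,
      ih, hτ.1, hτ.1, leibniz_lie x]
  · intro r
    simp
  · intro r u v hu hv
    simp only [map_add, lie_add, hu, hv]
  · intro r c u hu
    simp only [map_smul, lie_smul, hu]

theorem tauT_apply (h : IsAdT a adT) {τ : TensorAlgebra ℂ a →ₗ[ℂ] a} (hτ : IsTau a τ)
    {τt : TensorAlgebra ℂ a →ₗ[ℂ] Cur a} (hτt : IsTauT a τ τt) (x : a)
    {u : TensorAlgebra ℂ a} (hu : u ∈ FLie a) :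
    τt (adT x u) = ⁅((1 : ℂ[X]) ⊗ₜ[ℂ] x : Cur a), τt u⁆ := by
  induction hu using FLie_induction with
  | mem r u hu =>
    rw [hτt r _ (h.mem_Fr x r u hu), hτt r u hu, h.tau_apply hτ x r u hu,
      LieAlgebra.ExtendScalars.bracket_tmul, one_mul]
  | add u v _ _ hu hv => rw [map_add, map_add, hu, hv, map_add, Cur.lie_add]

end IsAdT

namespace IsTauT

variable {a : Type*} [LieRing a] [LieAlgebra ℂ a] {τ : TensorAlgebra ℂ a →ₗ[ℂ] a}
  {τt : TensorAlgebra ℂ a →ₗ[ℂ] Cur a}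

theorem apply_commutator (hτt : IsTauT a τ τt) (hτ : IsTau a τ) {u v : TensorAlgebra ℂ a}
    (hu : u ∈ FLie a) (hv : v ∈ FLie a) : τt (u * v - v * u) = ⁅τt u, τt v⁆ := by
  induction hu using FLie_induction with
  | mem r u hu =>
    induction hv using FLie_induction with
    | mem s v hv =>
      rw [hτt _ _ (commutator_mem_Fr r u hu s v hv), hτt r u hu, hτt s v hv,
        hτ.2 r s u hu v hv, LieAlgebra.ExtendScalars.bracket_tmul, pow_add]
    | add v v' _ _ hv hv' =>
      rw [map_add, Cur.lie_add, ← hv, ← hv', ← map_add]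
      congr 1
      noncomm_ring
  | add u u' _ _ hu hu' =>
    rw [map_add, Cur.add_lie, ← hu, ← hu', ← map_add]
    congr 1
    noncomm_ring

theorem constantCoeff_eq_zero (hτt : IsTauT a τ τt) {u : TensorAlgebra ℂ a}
    (hu : u ∈ FLie a) :
    TensorProduct.lid ℂ a ((Polynomial.lcoeff ℂ 0).rTensor a (τt u)) = 0 := by
  induction hu using FLie_induction with
  | mem r u hu =>
    cases r with
    | zero =>
      rw [(Submodule.mem_bot ℂ).1 hu]
      simp
    | succ r =>
      rw [hτt _ u hu]
      simp [LinearMap.rTensor_tmul]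
  | add u v _ _ hu hv => rw [map_add, map_add, map_add, hu, hv, add_zero]

theorem PhiF_eq_zero_iff (hτt : IsTauT a τ τt) {p : a × TensorAlgebra ℂ a}
    (hp : p.2 ∈ FLie a) : PhiF a τt p = 0 ↔ p.1 = 0 ∧ τt p.2 = 0 := by
  constructor
  · intro h
    have h₁ : p.1 = 0 := by
      have := congrArg (fun w => TensorProduct.lid ℂ a ((Polynomial.lcoeff ℂ 0).rTensor a w)) h
      simpa [PhiF, hτt.constantCoeff_eq_zero hp] using this
    refine ⟨h₁, ?_⟩
    simpa [PhiF, h₁] using h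
  · rintro ⟨h₁, h₂⟩
    simp [PhiF, h₁, h₂]

end IsTauT

theorem IsTau.map_Fr_succ {a : Type*} [LieRing a] [LieAlgebra ℂ a]
    {τ : TensorAlgebra ℂ a →ₗ[ℂ] a} (hτ : IsTau a τ)
    (ha : Submodule.span ℂ {z : a | ∃ x y : a, z = ⁅x, y⁆} = ⊤) (r : ℕ) :
    (Fr a (r + 1)).map τ = ⊤ := by
  induction r with
  | zero => exact eq_top_iff.2 fun x _ => ⟨ι ℂ x, ι_mem_Fr_one x, hτ.1 x⟩
  | succ r ih =>
    rw [eq_top_iff, ← ha, Submodule.span_le]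
    rintro _ ⟨x, y, rfl⟩
    obtain ⟨v, hv, rfl⟩ : y ∈ (Fr a (r + 1)).map τ := ih ▸ Submodule.mem_top
    refine ⟨_, ι_commutator_mem_Fr x hv, ?_⟩
    rw [hτ.2 1 _ _ (ι_mem_Fr_one _) _ hv, hτ.1]

theorem PhiF_add {a : Type*} [LieRing a] [LieAlgebra ℂ a]
    (τt : TensorAlgebra ℂ a →ₗ[ℂ] Cur a) (p q : a × TensorAlgebra ℂ a) :
    PhiF a τt (p + q) = PhiF a τt p + PhiF a τt q := by
  simp only [PhiF, Prod.fst_add, Prod.snd_add, tmul_add, map_add]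
  abel

theorem IsTauT.PhiF_surjective {a : Type*} [LieRing a] [LieAlgebra ℂ a]
    {τ : TensorAlgebra ℂ a →ₗ[ℂ] a} {τt : TensorAlgebra ℂ a →ₗ[ℂ] Cur a}
    (hτt : IsTauT a τ τt) (hτ : IsTau a τ)
    (ha : Submodule.span ℂ {z : a | ∃ x y : a, z = ⁅x, y⁆} = ⊤) (w : Cur a) :
    ∃ p : a × TensorAlgebra ℂ a, p.2 ∈ FLie a ∧ PhiF a τt p = w := by
  have add : ∀ w w' : Cur a, (∃ p : a × TensorAlgebra ℂ a, p.2 ∈ FLie a ∧ PhiF a τt p = w) →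
      (∃ p : a × TensorAlgebra ℂ a, p.2 ∈ FLie a ∧ PhiF a τt p = w') →
      ∃ p : a × TensorAlgebra ℂ a, p.2 ∈ FLie a ∧ PhiF a τt p = w + w' := by
    rintro _ _ ⟨p, hp, rfl⟩ ⟨q, hq, rfl⟩
    exact ⟨p + q, add_mem hp hq, PhiF_add τt p q⟩
  induction w using TensorProduct.induction_on with
  | zero => exact ⟨0, zero_mem _, by simp [PhiF]⟩
  | add w w' hw hw' => exact add w w' hw hw'
  | tmul f x =>
    induction f using Polynomial.induction_on' with
    | add f g hf hg =>
      rw [add_tmul]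
      exact add _ _ hf hg
    | monomial n c =>
      rw [← mul_one c, ← smul_eq_mul, ← smul_monomial, smul_tmul, monomial_one_right_eq_X_pow]
      cases n with
      | zero => exact ⟨(c • x, 0), zero_mem _, by simp [PhiF]⟩
      | succ n =>
        obtain ⟨u, hu, hux⟩ : c • x ∈ (Fr a (n + 1)).map τ :=
          hτ.map_Fr_succ ha n ▸ Submodule.mem_top
        exact ⟨(0, u), Fr_le_FLie a _ hu, by simp [PhiF, hτt _ u hu, hux]⟩

theorem PhiF_Fbr {a : Type*} [LieRing a] [LieAlgebra ℂ a]
    {τ : TensorAlgebra ℂ a →ₗ[ℂ] a} (hτ : IsTau a τ)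
    {τt : TensorAlgebra ℂ a →ₗ[ℂ] Cur a} (hτt : IsTauT a τ τt)
    {adT : a →ₗ[ℂ] Module.End ℂ (TensorAlgebra ℂ a)} (hadT : IsAdT a adT)
    {p q : a × TensorAlgebra ℂ a} (hp : p.2 ∈ FLie a) (hq : q.2 ∈ FLie a) :
    PhiF a τt (Fbr a adT p q) = ⁅PhiF a τt p, PhiF a τt q⁆ := by
  simp only [PhiF, Fbr]
  rw [map_add, map_sub, hadT.tauT_apply hτ hτt _ hq, hadT.tauT_apply hτ hτt _ hp,
    hτt.apply_commutator hτ hp hq, Cur.add_lie, Cur.lie_add, Cur.lie_add,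
    LieAlgebra.ExtendScalars.bracket_tmul, one_mul, ← Cur.lie_skew (τt p.2) ((1 : ℂ[X]) ⊗ₜ[ℂ] q.1)]
  abel

/-- `𝔉 = a ⊕ F(a)` with the bracket `Fbr` is a Lie algebra (in particular the
bracket is well defined on `𝔉`, i.e. `F(a)` is invariant under `ad_T` and closed under the
commutator bracket, and the bracket is alternating, bilinear and satisfies the Jacobi identity),
and if `a = [a,a]` then the extension of `τ[t]` to `𝔉` by `x ↦ x ⊗ 1` is a surjective Lie
algebra homomorphism `𝔉 → a[t]` whose kernel is `ker τ[t]`, so `a[t] ≅ 𝔉 / ker τ[t]`. -/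
theorem statement2 (a : Type*) [LieRing a] [LieAlgebra ℂ a]
    (τ : TensorAlgebra ℂ a →ₗ[ℂ] a) (hτ : IsTau a τ)
    (τt : TensorAlgebra ℂ a →ₗ[ℂ] Cur a) (hτt : IsTauT a τ τt)
    (adT : a →ₗ[ℂ] Module.End ℂ (TensorAlgebra ℂ a)) (hadT : IsAdT a adT) :
    -- the bracket is well defined on 𝔉 = a ⊕ F(a)
    ((∀ x : a, ∀ u ∈ FLie a, adT x u ∈ FLie a) ∧
     (∀ u ∈ FLie a, ∀ v ∈ FLie a, u * v - v * u ∈ FLie a) ∧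
    -- 𝔉 is a Lie algebra
     (∀ p : a × TensorAlgebra ℂ a, p.2 ∈ FLie a → Fbr a adT p p = 0) ∧
     (∀ p q r : a × TensorAlgebra ℂ a, p.2 ∈ FLie a → q.2 ∈ FLie a → r.2 ∈ FLie a →
        Fbr a adT (p + q) r = Fbr a adT p r + Fbr a adT q r) ∧
     (∀ (c : ℂ) (p q : a × TensorAlgebra ℂ a), p.2 ∈ FLie a → q.2 ∈ FLie a →
        Fbr a adT (c • p) q = c • Fbr a adT p q) ∧
     (∀ p q r : a × TensorAlgebra ℂ a, p.2 ∈ FLie a → q.2 ∈ FLie a → r.2 ∈ FLie a →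
        Fbr a adT p (Fbr a adT q r) =
          Fbr a adT (Fbr a adT p q) r + Fbr a adT q (Fbr a adT p r))) ∧
    -- the extension of τ[t] to 𝔉 is a homomorphism of Lie algebras, with kernel ker τ[t]
    ((∀ p q : a × TensorAlgebra ℂ a, p.2 ∈ FLie a → q.2 ∈ FLie a →
        PhiF a τt (Fbr a adT p q) = ⁅PhiF a τt p, PhiF a τt q⁆) ∧
     (∀ p : a × TensorAlgebra ℂ a, p.2 ∈ FLie a →
        (PhiF a τt p = 0 ↔ p.1 = 0 ∧ τt p.2 = 0)) ∧
    -- and it is surjective onto a[t] when a = [a,a]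
     (Submodule.span ℂ {z : a | ∃ x y : a, z = ⁅x, y⁆} = ⊤ →
        ∀ w : Cur a, ∃ p : a × TensorAlgebra ℂ a, p.2 ∈ FLie a ∧ PhiF a τt p = w)) := by
  refine ⟨⟨fun x _ => hadT.mem_FLie x, fun _ hu _ => commutator_mem_FLie hu, ?_, ?_, ?_,
    fun p q r _ _ _ => hadT.Fbr_jacobi p q r⟩, fun _ _ => PhiF_Fbr hτ hτt hadT,
    fun _ => hτt.PhiF_eq_zero_iff, hτt.PhiF_surjective hτ⟩
  · intro p _
    simp [Fbr]
  · intro p q r _ _ _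
    refine Prod.ext (add_lie _ _ _) ?_
    simp only [Fbr, Prod.fst_add, Prod.snd_add, map_add, LinearMap.add_apply]
    noncomm_ring
  · intro c p q _ _
    refine Prod.ext (smul_lie _ _ _) ?_
    simp [Fbr, smul_sub]
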